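/- Let 1 < α < 2, let β satisfy α-1 ≤ β ≤ 1, set λ_n := [sin(πα)/(sin(π(α-β)) + sin(πβ))]·Γ(n+α)/n!, let f : (0,1) → ℝ satisfy ∫₀¹ ρ^{(β-1,α-β-1)} f² < ∞, and define f_i := ∫₀¹ ρ^{(β-1,α-β-1)}(x) f(x) G_i^{(β-1,α-β-1)}(x) dx, c_i := f_{i+1}/(λ_i·|‖G_{i+1}^{(β-1,α-β-1)}‖|²), S_N(x) := Σ_{i=0}^{N-1} c_i G_i^{(α-β,β)}(x), and F_N(x) := Σ_{i=0}^{N} [f_i/|‖G_i^{(β-1,α-β-1)}‖|²] G_i^{(β-1,α-β-1)}(x). Then for each integer j ≥ 0 there exists a constant C > 0, depending only on α, β, j, such that for all integers M > N ≥ 1, ∫₀¹ ρ^{(α-β+j, β+j)}(x) ( D^j(S_M - S_N)(x) )² dx ≤ C · N^{-2(α-1)} · ∫₀¹ ρ^{(β+j-1, α-β+j-1)}(x) ( D^j(F_M - F_N)(x) )² dx, where D^j denotes the j-th derivative. -/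

import Mathlib

open Real MeasureTheory

/-- Jacobi polynomial `P_n^{(a,b)}(x)`. -/
noncomputable def jacobiP (a b : ℝ) (n : ℕ) (x : ℝ) : ℝ :=
  ∑ m ∈ Finset.range (n + 1),
    (1 / 2 ^ n : ℝ) *
      (Real.Gamma ((n : ℝ) + a + 1) /
        (Real.Gamma ((m : ℝ) + 1) * Real.Gamma ((n : ℝ) + a - (m : ℝ) + 1))) *
      (Real.Gamma ((n : ℝ) + b + 1) /
        (Real.Gamma ((n : ℝ) - (m : ℝ) + 1) * Real.Gamma (b + (m : ℝ) + 1))) *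
      (x - 1) ^ (n - m) * (x + 1) ^ m

/-- Shifted Jacobi polynomial `G_n^{(a,b)}(t) = P_n^{(a,b)}(2t-1)`. -/
noncomputable def jacobiG (a b : ℝ) (n : ℕ) (t : ℝ) : ℝ :=
  jacobiP a b n (2 * t - 1)

/-- Square of the norm constant `|‖G_n^{(a,b)}‖|`. -/
noncomputable def Gnorm2 (a b : ℝ) (n : ℕ) : ℝ :=
  Real.Gamma ((n : ℝ) + a + 1) * Real.Gamma ((n : ℝ) + b + 1) /
    ((2 * (n : ℝ) + a + b + 1) * Real.Gamma ((n : ℝ) + 1) * Real.Gamma ((n : ℝ) + a + b + 1))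

/-- The weight function `ρ^{(a,b)}(x) = (1-x)^a x^b`. -/
noncomputable def rho (a b x : ℝ) : ℝ := (1 - x) ^ a * x ^ b

/-- The eigenvalue `λ_n = [sin(πα)/(sin(π(α-β))+sin(πβ))]·Γ(n+α)/n!`. -/
noncomputable def lamda (α β : ℝ) (n : ℕ) : ℝ :=
  Real.sin (π * α) / (Real.sin (π * (α - β)) + Real.sin (π * β)) *
    (Real.Gamma ((n : ℝ) + α) / (n.factorial : ℝ))

/-- Coefficient of `(t - 1) ^ k * t ^ m` in the shifted Jacobi polynomial of degree `k + m`. -/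
noncomputable def jacobiCoeff (a b : ℝ) (k m : ℕ) : ℝ :=
  Real.Gamma (k + m + a + 1) * Real.Gamma (k + m + b + 1) /
    (m.factorial * Real.Gamma (k + a + 1) * (k.factorial * Real.Gamma (m + b + 1)))

lemma jacobiG_eq_sum_antidiagonal (a b : ℝ) (n : ℕ) (t : ℝ) :
    jacobiG a b n t =
      ∑ p ∈ Finset.HasAntidiagonal.antidiagonal n,
        jacobiCoeff a b p.1 p.2 * ((t - 1) ^ p.1 * t ^ p.2) := by
  rw [← Finset.Nat.sum_antidiagonal_swap, Finset.Nat.sum_antidiagonal_eq_sum_range_succ_mk,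
    jacobiG, jacobiP]
  refine Finset.sum_congr rfl fun m hm => ?_
  obtain ⟨k, rfl⟩ := Nat.exists_eq_add_of_le (Nat.lt_succ_iff.mp (Finset.mem_range.mp hm))
  have h1 : ((m + k : ℕ) : ℝ) + a - m + 1 = k + a + 1 := by push_cast; ring
  have h2 : ((m + k : ℕ) : ℝ) - m + 1 = k + 1 := by push_cast; ring
  have h3 : ((m + k : ℕ) : ℝ) = k + m := by push_cast; ring
  rw [h1, h2, h3]
  simp only [Nat.add_sub_cancel_left, Prod.swap_prod_mk, jacobiCoeff, Real.Gamma_nat_eq_factorial]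
  have h4 : 2 * t - 1 - 1 = 2 * (t - 1) := by ring
  have h5 : 2 * t - 1 + 1 = 2 * t := by ring
  rw [h4, h5, mul_pow, mul_pow, add_comm b (m : ℝ), pow_add, div_mul_div_comm]
  have h6 : (2 : ℝ) ^ m ≠ 0 := by positivity
  have h7 : (2 : ℝ) ^ k ≠ 0 := by positivity
  field_simp

lemma jacobiCoeff_succ_left {a b : ℝ} (ha : -1 < a) (hb : -1 < b) (k m : ℕ) :
    (k + 1) * jacobiCoeff a b (k + 1) m = (m + b + 1) * jacobiCoeff (a + 1) (b + 1) k m := by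
  have hm : (0 : ℝ) < m + b + 1 := by have := m.cast_nonneg (α := ℝ); linarith
  have hk : (0 : ℝ) < k + (a + 1) + 1 := by have := k.cast_nonneg (α := ℝ); linarith
  have hΓ := Real.Gamma_add_one hm.ne'
  have hm' := (Real.Gamma_pos_of_pos hm).ne'
  have hk' := (Real.Gamma_pos_of_pos hk).ne'
  rw [jacobiCoeff, jacobiCoeff, Nat.factorial_succ]
  push_cast
  rw [show (k : ℝ) + 1 + m + a + 1 = k + m + (a + 1) + 1 by ring,
    show (k : ℝ) + 1 + m + b + 1 = k + m + (b + 1) + 1 by ring,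
    show (k : ℝ) + 1 + a + 1 = k + (a + 1) + 1 by ring,
    show (m : ℝ) + (b + 1) + 1 = m + b + 1 + 1 by ring, hΓ]
  field_simp

lemma jacobiCoeff_swap (a b : ℝ) (k m : ℕ) : jacobiCoeff a b k m = jacobiCoeff b a m k := by
  rw [jacobiCoeff, jacobiCoeff, add_comm (k : ℝ) m]
  ring

lemma jacobiCoeff_succ_right {a b : ℝ} (ha : -1 < a) (hb : -1 < b) (k m : ℕ) :
    (m + 1) * jacobiCoeff a b k (m + 1) = (k + a + 1) * jacobiCoeff (a + 1) (b + 1) k m := by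
  rw [jacobiCoeff_swap, jacobiCoeff_succ_left hb ha, jacobiCoeff_swap]

lemma jacobiG_zero {a b : ℝ} (ha : -1 < a) (hb : -1 < b) : jacobiG a b 0 = fun _ => 1 := by
  ext t
  have h1 := (Real.Gamma_pos_of_pos (show 0 < a + 1 by linarith)).ne'
  have h2 := (Real.Gamma_pos_of_pos (show 0 < b + 1 by linarith)).ne'
  simp [jacobiG, jacobiP, h1, h2]

lemma jacobiG_one_sub (a b : ℝ) (n : ℕ) (t : ℝ) :
    jacobiG a b n (1 - t) = (-1) ^ n * jacobiG b a n t := by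
  rw [jacobiG_eq_sum_antidiagonal, jacobiG_eq_sum_antidiagonal, Finset.mul_sum,
    ← Finset.Nat.sum_antidiagonal_swap]
  refine Finset.sum_congr rfl fun p hp => ?_
  rw [← Finset.HasAntidiagonal.mem_antidiagonal.mp hp, Prod.fst_swap, Prod.snd_swap,
    jacobiCoeff_swap,
    show 1 - t - 1 = -1 * t by ring, show 1 - t = -1 * (t - 1) by ring, mul_pow, mul_pow, pow_add]
  ring

lemma contDiff_jacobiG (a b : ℝ) (n : ℕ) {r : WithTop ℕ∞} : ContDiff ℝ r (jacobiG a b n) := by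
  unfold jacobiG jacobiP
  fun_prop

/-- The derivative of a shifted Jacobi polynomial, computed term by term. -/
lemma hasDerivAt_jacobiG_sum (a b : ℝ) (n : ℕ) (t : ℝ) :
    HasDerivAt (jacobiG a b n) (∑ p ∈ Finset.HasAntidiagonal.antidiagonal n,
      jacobiCoeff a b p.1 p.2 * (p.1 * (t - 1) ^ (p.1 - 1) * t ^ p.2 +
        (t - 1) ^ p.1 * (p.2 * t ^ (p.2 - 1)))) t := by
  rw [funext (jacobiG_eq_sum_antidiagonal a b n)]
  refine HasDerivAt.fun_sum fun p _ => HasDerivAt.const_mul _ (HasDerivAt.mul ?_ ?_)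
  · simpa using ((hasDerivAt_id t).sub_const 1).fun_pow p.1
  · exact hasDerivAt_pow p.2 t

lemma hasDerivAt_jacobiG_succ {a b : ℝ} (ha : -1 < a) (hb : -1 < b) (n : ℕ) (t : ℝ) :
    HasDerivAt (jacobiG a b (n + 1)) ((n + 1 + (a + b + 1)) * jacobiG (a + 1) (b + 1) n t) t := by
  convert hasDerivAt_jacobiG_sum a b (n + 1) t using 1
  simp only [mul_add, Finset.sum_add_distrib]
  rw [Finset.Nat.sum_antidiagonal_succ, Finset.Nat.sum_antidiagonal_succ',
    jacobiG_eq_sum_antidiagonal, Finset.mul_sum]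
  simp only [Nat.cast_zero, zero_mul, mul_zero, zero_add, Nat.add_sub_cancel]
  rw [← Finset.sum_add_distrib]
  refine Finset.sum_congr rfl fun p hp => ?_
  have h1 := jacobiCoeff_succ_left ha hb p.1 p.2
  have h2 := jacobiCoeff_succ_right ha hb p.1 p.2
  rw [← Finset.HasAntidiagonal.mem_antidiagonal.mp hp]
  push_cast
  linear_combination (-(t - 1) ^ p.1 * t ^ p.2) * (h1 + h2)

/-- The first-order raising relation for shifted Jacobi polynomials. -/
lemma jacobiG_raising {a b : ℝ} (ha : -1 < a) (hb : -1 < b) (n : ℕ) (t : ℝ) :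
    (b + 1) * (1 - t) * jacobiG (a + 1) (b + 1) n t - (a + 1) * t * jacobiG (a + 1) (b + 1) n t
      + t * (1 - t) * deriv (jacobiG (a + 1) (b + 1) n) t = -((n + 1) * jacobiG a b (n + 1) t) := by
  have hsplit : (n + 1) * jacobiG a b (n + 1) t =
      ∑ p ∈ Finset.HasAntidiagonal.antidiagonal (n + 1),
        (p.1 * jacobiCoeff a b p.1 p.2 * ((t - 1) ^ p.1 * t ^ p.2) +
          p.2 * jacobiCoeff a b p.1 p.2 * ((t - 1) ^ p.1 * t ^ p.2)) := by
    rw [jacobiG_eq_sum_antidiagonal, Finset.mul_sum]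
    refine Finset.sum_congr rfl fun p hp => ?_
    have : (p.1 : ℝ) + p.2 = n + 1 := mod_cast Finset.HasAntidiagonal.mem_antidiagonal.mp hp
    rw [← this]
    ring
  rw [hsplit, Finset.sum_add_distrib, Finset.Nat.sum_antidiagonal_succ,
    Finset.Nat.sum_antidiagonal_succ', (hasDerivAt_jacobiG_sum _ _ n t).deriv,
    jacobiG_eq_sum_antidiagonal]
  simp only [Nat.cast_zero, zero_mul, zero_add, Finset.mul_sum]
  rw [← Finset.sum_sub_distrib, ← Finset.sum_add_distrib, ← Finset.sum_add_distrib,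
    ← Finset.sum_neg_distrib]
  refine Finset.sum_congr rfl fun p _ => ?_
  push_cast
  rw [jacobiCoeff_succ_left ha hb, jacobiCoeff_succ_right ha hb]
  have h1 : (p.1 : ℝ) * (t - 1) ^ (p.1 - 1) * (t - 1) = p.1 * (t - 1) ^ p.1 := by
    rcases p.1 with _ | k
    · simp
    · rw [Nat.add_sub_cancel, pow_succ]; ring
  have h2 : (p.2 : ℝ) * t ^ (p.2 - 1) * t = p.2 * t ^ p.2 := by
    rcases p.2 with _ | k
    · simp
    · rw [Nat.add_sub_cancel, pow_succ]; ring
  linear_combination (jacobiCoeff (a + 1) (b + 1) p.1 p.2) *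
    (-t * t ^ p.2 * h1 + (1 - t) * (t - 1) ^ p.1 * h2)

lemma intervalIntegrable_rho {a b : ℝ} (ha : -1 < a) (hb : -1 < b) :
    IntervalIntegrable (rho a b) volume 0 1 := by
  have h := (Complex.betaIntegral_convergent (u := ((b + 1 : ℝ) : ℂ)) (v := ((a + 1 : ℝ) : ℂ))
    (by simpa using by linarith) (by simpa using by linarith)).norm
  refine h.congr fun x hx => ?_
  rw [Set.uIoc_of_le zero_le_one] at hx
  have h1 : 0 ≤ 1 - x := by linarith [hx.2]
  have e1 : (x : ℂ) ^ (((b + 1 : ℝ) : ℂ) - 1) = ((x ^ b : ℝ) : ℂ) := by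
    rw [Complex.ofReal_cpow hx.1.le]; congr 1; push_cast; ring
  have e2 : (1 - (x : ℂ)) ^ (((a + 1 : ℝ) : ℂ) - 1) = (((1 - x) ^ a : ℝ) : ℂ) := by
    rw [Complex.ofReal_cpow h1]; congr 1 <;> push_cast <;> ring
  simp only [e1, e2]
  rw [← Complex.ofReal_mul, Complex.norm_real, Real.norm_of_nonneg (mul_nonneg
    (Real.rpow_nonneg hx.1.le _) (Real.rpow_nonneg h1 _)), rho, mul_comm]

lemma intervalIntegrable_rho_mul {a b : ℝ} (ha : -1 < a) (hb : -1 < b) {g : ℝ → ℝ}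
    (hg : Continuous g) : IntervalIntegrable (fun x => rho a b x * g x) volume 0 1 :=
  (intervalIntegrable_rho ha hb).mul_continuousOn hg.continuousOn

lemma rho_add_one {a b x : ℝ} (hx : x ∈ Set.Ioo (0 : ℝ) 1) :
    rho (a + 1) (b + 1) x = rho a b x * (x * (1 - x)) := by
  rw [rho, rho, Real.rpow_add_one (by linarith [hx.2]), Real.rpow_add_one hx.1.ne']
  ring

lemma hasDerivAt_rho_add_one {a b x : ℝ} (hx : x ∈ Set.Ioo (0 : ℝ) 1) :
    HasDerivAt (rho (a + 1) (b + 1)) (rho a b x * ((b + 1) * (1 - x) - (a + 1) * x)) x := by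
  have h1 : (1 : ℝ) - x ≠ 0 := by linarith [hx.2]
  have d1 := ((hasDerivAt_id x).const_sub 1).rpow_const (p := a + 1) (Or.inl h1)
  have d2 := (hasDerivAt_id x).rpow_const (p := b + 1) (Or.inl hx.1.ne')
  have d := d1.mul d2
  simp only [id, add_sub_cancel_right, Real.rpow_add_one h1, Real.rpow_add_one hx.1.ne'] at d
  refine d.congr_deriv ?_
  rw [rho]
  ring

/-- Integration by parts of a shifted Jacobi polynomial against a smooth function. -/
lemma integral_rho_mul_jacobiG_succ_mul {a b : ℝ} (ha : -1 < a) (hb : -1 < b) (n : ℕ)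
    {q q' : ℝ → ℝ} (hq : ∀ x, HasDerivAt q (q' x) x) (hq' : Continuous q') :
    (n + 1) * ∫ x in (0 : ℝ)..1, rho a b x * (jacobiG a b (n + 1) x * q x) =
      ∫ x in (0 : ℝ)..1, rho (a + 1) (b + 1) x * (jacobiG (a + 1) (b + 1) n x * q' x) := by
  have hqc : Continuous q := continuous_iff_continuousAt.mpr fun x => (hq x).continuousAt
  have hG (a b : ℝ) (n : ℕ) : Continuous (jacobiG a b n) :=
    (contDiff_jacobiG a b n (r := 0)).continuous
  have hi1 := intervalIntegrable_rho_mul ha hb (g := fun x => jacobiG a b (n + 1) x * q x)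
    ((hG a b (n + 1)).mul hqc)
  have hi2 := intervalIntegrable_rho_mul (show -1 < a + 1 by linarith)
    (show -1 < b + 1 by linarith) (g := fun x => jacobiG (a + 1) (b + 1) n x * q' x)
    ((hG (a + 1) (b + 1) n).mul hq')
  have key := intervalIntegral.integral_eq_sub_of_hasDerivAt_of_le zero_le_one
    (f := fun x => rho (a + 1) (b + 1) x * (jacobiG (a + 1) (b + 1) n x * q x))
    (f' := fun x => rho (a + 1) (b + 1) x * (jacobiG (a + 1) (b + 1) n x * q' x) -
      (n + 1) * (rho a b x * (jacobiG a b (n + 1) x * q x))) ?_ ?_ (hi2.sub (hi1.const_mul _))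
  · rw [intervalIntegral.integral_sub hi2 (hi1.const_mul _),
      intervalIntegral.integral_const_mul] at key
    have h0 : rho (a + 1) (b + 1) 0 = 0 := by
      rw [rho, Real.zero_rpow (by linarith), mul_zero]
    have h1 : rho (a + 1) (b + 1) 1 = 0 := by
      rw [rho, sub_self, Real.zero_rpow (by linarith), zero_mul]
    simp only [h0, h1, zero_mul] at key
    linarith
  · have hρ : Continuous (rho (a + 1) (b + 1)) :=
      ((continuous_const.sub continuous_id).rpow_const fun _ => Or.inr (by linarith)).mul
        (continuous_id.rpow_const fun _ => Or.inr (by linarith))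
    exact (hρ.mul ((hG _ _ n).mul hqc)).continuousOn
  · intro x hx
    have dG := ((contDiff_jacobiG (a + 1) (b + 1) n (r := 1)).differentiable one_ne_zero
      x).hasDerivAt
    refine ((hasDerivAt_rho_add_one hx).mul (dG.mul (hq x))).congr_deriv ?_
    rw [rho_add_one hx]
    simp only [Pi.mul_apply]
    linear_combination rho a b x * q x * jacobiG_raising ha hb n x

lemma integral_rho_mul_jacobiG_succ_mul_jacobiG_succ {a b : ℝ} (ha : -1 < a) (hb : -1 < b)
    (n m : ℕ) :
    (n + 1) * ∫ x in (0 : ℝ)..1, rho a b x * (jacobiG a b (n + 1) x * jacobiG a b (m + 1) x) =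
      (m + 1 + (a + b + 1)) * ∫ x in (0 : ℝ)..1, rho (a + 1) (b + 1) x *
        (jacobiG (a + 1) (b + 1) n x * jacobiG (a + 1) (b + 1) m x) := by
  rw [integral_rho_mul_jacobiG_succ_mul ha hb n (hasDerivAt_jacobiG_succ ha hb m)
    ((contDiff_jacobiG _ _ m (r := 0)).continuous.const_mul _),
    ← intervalIntegral.integral_const_mul]
  congr 1 with x
  ring

lemma integral_rho_mul_jacobiG_succ_mul_jacobiG_zero {a b : ℝ} (ha : -1 < a) (hb : -1 < b)
    (n : ℕ) :
    ∫ x in (0 : ℝ)..1, rho a b x * (jacobiG a b (n + 1) x * jacobiG a b 0 x) = 0 := by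
  have h := integral_rho_mul_jacobiG_succ_mul ha hb n
    (q := jacobiG a b 0) (q' := fun _ => 0)
    (fun x => by rw [jacobiG_zero ha hb]; exact hasDerivAt_const x 1) continuous_const
  simp only [mul_zero, intervalIntegral.integral_zero] at h
  exact (mul_eq_zero.mp h).resolve_left n.cast_add_one_ne_zero

lemma integral_rho_mul_jacobiG_mul_jacobiG_of_ne {a b : ℝ} (ha : -1 < a) (hb : -1 < b)
    {n m : ℕ} (hnm : n ≠ m) :
    ∫ x in (0 : ℝ)..1, rho a b x * (jacobiG a b n x * jacobiG a b m x) = 0 := by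
  induction n generalizing a b m with
  | zero =>
    obtain ⟨m, rfl⟩ := Nat.exists_eq_succ_of_ne_zero hnm.symm
    simp_rw [mul_comm (jacobiG a b 0 _)]
    exact integral_rho_mul_jacobiG_succ_mul_jacobiG_zero ha hb m
  | succ n ih =>
    rcases m with _ | m
    · exact integral_rho_mul_jacobiG_succ_mul_jacobiG_zero ha hb n
    · have h := integral_rho_mul_jacobiG_succ_mul_jacobiG_succ ha hb n m
      rw [ih (by linarith) (by linarith) (by omega), mul_zero] at h
      exact (mul_eq_zero.mp h).resolve_left n.cast_add_one_ne_zero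

/-- The squared weighted `L²` norm of the shifted Jacobi polynomial. -/
noncomputable def jacobiNormSq (a b : ℝ) (n : ℕ) : ℝ :=
  ∫ x in (0 : ℝ)..1, rho a b x * (jacobiG a b n x * jacobiG a b n x)

lemma jacobiNormSq_succ {a b : ℝ} (ha : -1 < a) (hb : -1 < b) (n : ℕ) :
    (n + 1) * jacobiNormSq a b (n + 1) =
      (n + 1 + (a + b + 1)) * jacobiNormSq (a + 1) (b + 1) n :=
  integral_rho_mul_jacobiG_succ_mul_jacobiG_succ ha hb n n

lemma jacobiNormSq_comm (a b : ℝ) (n : ℕ) : jacobiNormSq a b n = jacobiNormSq b a n := by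
  have h := intervalIntegral.integral_comp_sub_left (a := 0) (b := 1)
    (fun x => rho a b x * (jacobiG a b n x * jacobiG a b n x)) 1
  rw [sub_self, sub_zero] at h
  rw [jacobiNormSq, ← h, jacobiNormSq]
  congr 1 with x
  rw [jacobiG_one_sub, rho, rho, sub_sub_cancel]
  have hs : ((-1 : ℝ) ^ n) * (-1) ^ n = 1 := by rw [← mul_pow]; simp
  linear_combination ((1 - x) ^ b * x ^ a * jacobiG b a n x ^ 2) * hs

lemma jacobiNormSq_nonneg (a b : ℝ) (n : ℕ) : 0 ≤ jacobiNormSq a b n :=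
  intervalIntegral.integral_nonneg zero_le_one fun _ hx =>
    mul_nonneg (mul_nonneg (Real.rpow_nonneg (by linarith [hx.2]) _) (Real.rpow_nonneg hx.1 _))
      (mul_self_nonneg _)

/-- The factor by which the squared weighted norm grows under `j` derivatives. -/
noncomputable def derivFactor (s : ℝ) (j n : ℕ) : ℝ :=
  ∏ l ∈ Finset.range j, ((n : ℝ) - l) * (n + s + l)

lemma derivFactor_succ_zero (s : ℝ) (j : ℕ) : derivFactor s (j + 1) 0 = 0 :=
  Finset.prod_eq_zero (Finset.mem_range.mpr j.succ_pos) (by simp)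

lemma derivFactor_succ_succ (s : ℝ) (j n : ℕ) :
    derivFactor s (j + 1) (n + 1) = derivFactor (s + 2) j n * ((n + 1) * (n + 1 + s)) := by
  rw [derivFactor, Finset.prod_range_succ', derivFactor]
  congr 1
  · refine Finset.prod_congr rfl fun l _ => ?_
    push_cast
    ring
  · simp

lemma derivFactor_eq_zero {s : ℝ} {j n : ℕ} (h : n < j) : derivFactor s j n = 0 :=
  Finset.prod_eq_zero (Finset.mem_range.mpr h) (by simp)

lemma derivFactor_nonneg {s : ℝ} (hs : 0 ≤ s) (j n : ℕ) : 0 ≤ derivFactor s j n := by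
  rcases lt_or_ge n j with h | h
  · exact (derivFactor_eq_zero h).ge
  · refine Finset.prod_nonneg fun l hl => mul_nonneg (sub_nonneg.mpr ?_) (by positivity)
    exact_mod_cast (Finset.mem_range.mp hl).le.trans h

lemma derivFactor_add_two_le {s : ℝ} (hs : 0 ≤ s) (j n : ℕ) :
    derivFactor (s + 2) j n ≤ derivFactor s j (n + 1) := by
  rcases lt_or_ge n j with h | h
  · exact (derivFactor_eq_zero h).trans_le (derivFactor_nonneg hs _ _)
  · refine Finset.prod_le_prod (fun l hl => mul_nonneg (sub_nonneg.mpr ?_) (by positivity))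
      fun l hl => ?_
    · exact_mod_cast (Finset.mem_range.mp hl).le.trans h
    · push_cast
      nlinarith [l.cast_nonneg (α := ℝ)]

lemma iteratedDeriv_succ_jacobiG_succ {a b : ℝ} (ha : -1 < a) (hb : -1 < b) (j n : ℕ) (x : ℝ) :
    iteratedDeriv (j + 1) (jacobiG a b (n + 1)) x =
      (n + 1 + (a + b + 1)) * iteratedDeriv j (jacobiG (a + 1) (b + 1) n) x := by
  rw [iteratedDeriv_succ', funext fun t => (hasDerivAt_jacobiG_succ ha hb n t).deriv,
    iteratedDeriv_const_mul_field]

lemma iteratedDeriv_succ_jacobiG_zero {a b : ℝ} (ha : -1 < a) (hb : -1 < b) (j : ℕ) (x : ℝ) :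
    iteratedDeriv (j + 1) (jacobiG a b 0) x = 0 := by
  rw [jacobiG_zero ha hb, iteratedDeriv_const]
  simp

/-- Derivatives of shifted Jacobi polynomials are orthogonal for the shifted weight. -/
lemma integral_rho_mul_iteratedDeriv_jacobiG {a b : ℝ} (ha : -1 < a) (hb : -1 < b) (j n m : ℕ) :
    ∫ x in (0 : ℝ)..1, rho (a + j) (b + j) x *
        (iteratedDeriv j (jacobiG a b n) x * iteratedDeriv j (jacobiG a b m) x) =
      if n = m then jacobiNormSq a b n * derivFactor (a + b + 1) j n else 0 := by
  induction j generalizing a b n m with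
  | zero =>
    simp only [Nat.cast_zero, add_zero, iteratedDeriv_zero, derivFactor, Finset.range_zero,
      Finset.prod_empty, mul_one]
    split_ifs with h
    · rw [h, jacobiNormSq]
    · exact integral_rho_mul_jacobiG_mul_jacobiG_of_ne ha hb h
  | succ j ih =>
    rcases n with _ | n
    · simp [iteratedDeriv_succ_jacobiG_zero ha hb, derivFactor_succ_zero]
    rcases m with _ | m
    · simp [iteratedDeriv_succ_jacobiG_zero ha hb]
    have h := ih (a := a + 1) (b := b + 1) (by linarith) (by linarith) n m
    have hfac (x : ℝ) : rho (a + (j + 1 : ℕ)) (b + (j + 1 : ℕ)) x *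
        (iteratedDeriv (j + 1) (jacobiG a b (n + 1)) x *
          iteratedDeriv (j + 1) (jacobiG a b (m + 1)) x) =
        ((n + 1 + (a + b + 1)) * (m + 1 + (a + b + 1))) * (rho (a + 1 + j) (b + 1 + j) x *
          (iteratedDeriv j (jacobiG (a + 1) (b + 1) n) x *
            iteratedDeriv j (jacobiG (a + 1) (b + 1) m) x)) := by
      rw [iteratedDeriv_succ_jacobiG_succ ha hb, iteratedDeriv_succ_jacobiG_succ ha hb]
      push_cast
      rw [add_right_comm a 1 (j : ℝ), add_right_comm b 1 (j : ℝ), ← add_assoc, ← add_assoc]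
      ring
    simp_rw [hfac]
    rw [intervalIntegral.integral_const_mul, h]
    rcases eq_or_ne n m with rfl | hnm
    · rw [if_pos rfl, if_pos rfl, derivFactor_succ_succ,
        show a + 1 + (b + 1) + 1 = a + b + 1 + 2 by ring]
      linear_combination (-(n + 1 + (a + b + 1)) * derivFactor (a + b + 1 + 2) j n) *
        jacobiNormSq_succ ha hb n
    · rw [if_neg hnm, if_neg (by omega), mul_zero]

/-- Parseval's identity for the derivatives of a finite expansion in shifted Jacobi polynomials. -/
lemma integral_rho_mul_iteratedDeriv_sum_sq {a b : ℝ} (ha : -1 < a) (hb : -1 < b) (j : ℕ)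
    (s : Finset ℕ) (c : ℕ → ℝ) :
    ∫ x in (0 : ℝ)..1, rho (a + j) (b + j) x *
        (iteratedDeriv j (fun y => ∑ i ∈ s, c i * jacobiG a b i y) x) ^ 2 =
      ∑ i ∈ s, c i ^ 2 * (jacobiNormSq a b i * derivFactor (a + b + 1) j i) := by
  have hexp (x : ℝ) : rho (a + j) (b + j) x *
        (iteratedDeriv j (fun y => ∑ i ∈ s, c i * jacobiG a b i y) x) ^ 2 =
      ∑ i ∈ s, ∑ k ∈ s, c i * c k * (rho (a + j) (b + j) x *
        (iteratedDeriv j (jacobiG a b i) x * iteratedDeriv j (jacobiG a b k) x)) := by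
    rw [iteratedDeriv_fun_sum fun i _ => (contDiff_const.mul (contDiff_jacobiG a b i)).contDiffAt]
    simp_rw [iteratedDeriv_const_mul_field]
    rw [sq, Finset.sum_mul_sum, Finset.mul_sum]
    refine Finset.sum_congr rfl fun i _ => ?_
    rw [Finset.mul_sum]
    exact Finset.sum_congr rfl fun k _ => by ring
  have hint (i k : ℕ) : IntervalIntegrable (fun x => c i * c k * (rho (a + j) (b + j) x *
      (iteratedDeriv j (jacobiG a b i) x * iteratedDeriv j (jacobiG a b k) x))) volume 0 1 := by
    have hj := j.cast_nonneg (α := ℝ)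
    have hc (i : ℕ) : Continuous (iteratedDeriv j (jacobiG a b i)) :=
      (contDiff_jacobiG a b i (r := j)).continuous_iteratedDeriv j le_rfl
    exact (intervalIntegrable_rho_mul (by linarith) (by linarith)
      ((hc i).mul (hc k))).const_mul _
  simp_rw [hexp]
  rw [intervalIntegral.integral_finsetSum fun i _ => by
    simpa only [Finset.sum_fn] using IntervalIntegrable.sum s fun k _ => hint i k]
  refine Finset.sum_congr rfl fun i hi => ?_
  rw [intervalIntegral.integral_finsetSum fun k _ => hint i k]
  simp_rw [intervalIntegral.integral_const_mul, integral_rho_mul_iteratedDeriv_jacobiG ha hb]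
  simp [hi, sq]

/-- Lower bound for a ratio of Gamma values, from log-convexity. -/
lemma rpow_le_Gamma_add_div_factorial {α : ℝ} (hα : 1 < α) {n : ℕ} (hn : 1 ≤ n) :
    (n : ℝ) ^ (α - 1) ≤ Real.Gamma (n + α) / n.factorial := by
  have hn0 : (0 : ℝ) < n := by exact_mod_cast hn
  have hα0 : 0 < α := by linarith
  have hΓ : 0 < Real.Gamma n := Real.Gamma_pos_of_pos hn0
  have hΓα : 0 < Real.Gamma (n + α) := Real.Gamma_pos_of_pos (by linarith)
  have hfac : (n.factorial : ℝ) = n * Real.Gamma n := by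
    rw [← Real.Gamma_nat_eq_factorial, Real.Gamma_add_one hn0.ne']
  have h := Real.Gamma_mul_add_mul_le_rpow_Gamma_mul_rpow_Gamma hn0
    (show 0 < (n : ℝ) + α by linarith) (a := (α - 1) / α) (b := 1 / α)
    (div_pos (by linarith) hα0) (by positivity) (by field_simp; ring)
  rw [show (α - 1) / α * (n : ℝ) + 1 / α * (n + α) = n + 1 by field_simp; ring,
    Real.Gamma_add_one hn0.ne'] at h
  have h' := Real.rpow_le_rpow (by positivity) h hα0.le
  rw [Real.mul_rpow hn0.le hΓ.le, Real.mul_rpow (by positivity) (by positivity),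
    ← Real.rpow_mul hΓ.le, ← Real.rpow_mul hΓα.le, div_mul_cancel₀ _ hα0.ne',
    div_mul_cancel₀ _ hα0.ne', Real.rpow_one] at h'
  have e1 : (n : ℝ) ^ α = n ^ (α - 1) * n := by
    rw [← Real.rpow_add_one hn0.ne', sub_add_cancel]
  have e2 : Real.Gamma n ^ α = Real.Gamma n ^ (α - 1) * Real.Gamma n := by
    rw [← Real.rpow_add_one hΓ.ne', sub_add_cancel]
  rw [e1, e2] at h'
  rw [le_div_iff₀ (by positivity), hfac]
  refine le_of_mul_le_mul_left ?_ (Real.rpow_pos_of_pos hΓ (α - 1))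
  linarith

lemma jacobiNormSq_mul_derivFactor_le {a b : ℝ} (ha : -1 < a) (hb : -1 < b)
    (hab : 0 ≤ a + b + 1) (j n : ℕ) :
    jacobiNormSq (b + 1) (a + 1) n * derivFactor (a + b + 1 + 2) j n ≤
      jacobiNormSq a b (n + 1) * derivFactor (a + b + 1) j (n + 1) := by
  refine mul_le_mul ?_ (derivFactor_add_two_le hab j n) (derivFactor_nonneg (by linarith) j n)
    (jacobiNormSq_nonneg _ _ _)
  rw [jacobiNormSq_comm]
  have hn : (0 : ℝ) < n + 1 := n.cast_add_one_pos
  refine le_of_mul_le_mul_left ?_ hn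
  rw [jacobiNormSq_succ ha hb]
  exact mul_le_mul_of_nonneg_right (by linarith) (jacobiNormSq_nonneg _ _ _)

lemma inv_lamda_sq_le {α : ℝ} (hα : 1 < α) (β : ℝ) {N n : ℕ} (hN : 1 ≤ N) (hn : N ≤ n) :
    (lamda α β n)⁻¹ ^ 2 ≤
      (Real.sin (π * α) / (Real.sin (π * (α - β)) + Real.sin (π * β)))⁻¹ ^ 2 *
        (N : ℝ) ^ (-2 * (α - 1)) := by
  have hN0 : (0 : ℝ) < N := by exact_mod_cast hN
  have hle : (N : ℝ) ^ (α - 1) ≤ Real.Gamma (n + α) / n.factorial :=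
    (Real.rpow_le_rpow hN0.le (by exact_mod_cast hn) (by linarith)).trans
      (rpow_le_Gamma_add_div_factorial hα (hN.trans hn))
  have hpos : 0 < (N : ℝ) ^ (α - 1) := Real.rpow_pos_of_pos hN0 _
  have hpow : (N : ℝ) ^ (-2 * (α - 1)) = ((N : ℝ) ^ (α - 1))⁻¹ ^ 2 := by
    rw [← Real.rpow_neg hN0.le, ← Real.rpow_natCast, ← Real.rpow_mul hN0.le]
    congr 1
    push_cast
    ring
  rw [lamda, mul_inv, mul_pow, hpow]
  gcongr

/-- Weighted `L²` bound for the `j`-th derivative of differences of partial sums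
in terms of `j`-th derivative of differences of truncated expansions of `f`. -/
theorem deriv_partial_sum_bound (α β : ℝ) (hα1 : 1 < α) (hα2 : α < 2)
    (hβ1 : α - 1 ≤ β) (hβ2 : β ≤ 1) (j : ℕ) :
    ∃ C : ℝ, 0 < C ∧
      ∀ f : ℝ → ℝ,
        IntegrableOn (fun x => rho (β - 1) (α - β - 1) x * f x ^ 2) (Set.Ioo 0 1) →
        ∀ fc : ℕ → ℝ,
          (∀ i, fc i = ∫ x in (0:ℝ)..1,
              rho (β - 1) (α - β - 1) x * f x * jacobiG (β - 1) (α - β - 1) i x) →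
        ∀ c : ℕ → ℝ,
          (∀ i, c i = fc (i + 1) / (lamda α β i * Gnorm2 (β - 1) (α - β - 1) (i + 1))) →
        ∀ S : ℕ → ℝ → ℝ,
          (∀ N x, S N x = ∑ i ∈ Finset.range N, c i * jacobiG (α - β) β i x) →
        ∀ F : ℕ → ℝ → ℝ,
          (∀ N x, F N x = ∑ i ∈ Finset.range (N + 1),
              fc i / Gnorm2 (β - 1) (α - β - 1) i * jacobiG (β - 1) (α - β - 1) i x) →
        ∀ M N : ℕ, 1 ≤ N → N < M →
          (∫ x in (0:ℝ)..1, rho (α - β + (j : ℝ)) (β + (j : ℝ)) x *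
              (iteratedDeriv j (fun y => S M y - S N y) x) ^ 2) ≤
            C * (N : ℝ) ^ (-2 * (α - 1)) *
              ∫ x in (0:ℝ)..1, rho (β + (j : ℝ) - 1) (α - β + (j : ℝ) - 1) x *
                (iteratedDeriv j (fun y => F M y - F N y) x) ^ 2 := by
  have ha : -1 < β - 1 := by linarith
  have hb : -1 < α - β - 1 := by linarith
  refine ⟨(Real.sin (π * α) / (Real.sin (π * (α - β)) + Real.sin (π * β)))⁻¹ ^ 2 + 1,
    by positivity, ?_⟩
  intro f _ fc _ c hc S hS F hF M N hN hNM
  have hSdiff : (fun y => S M y - S N y) =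
      fun y => ∑ i ∈ Finset.Ico N M, c i * jacobiG (α - β) β i y := by
    ext y
    rw [hS, hS, Finset.sum_Ico_eq_sub _ hNM.le]
  have hFdiff : (fun y => F M y - F N y) =
      fun y => ∑ i ∈ Finset.Ico (N + 1) (M + 1), fc i / Gnorm2 (β - 1) (α - β - 1) i *
        jacobiG (β - 1) (α - β - 1) i y := by
    ext y
    rw [hF, hF, Finset.sum_Ico_eq_sub _ (by omega)]
  rw [hSdiff, hFdiff, integral_rho_mul_iteratedDeriv_sum_sq (by linarith) (by linarith),
    show β + (j : ℝ) - 1 = β - 1 + j by ring, show α - β + (j : ℝ) - 1 = α - β - 1 + j by ring,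
    integral_rho_mul_iteratedDeriv_sum_sq ha hb, ← Finset.sum_Ico_add', Finset.mul_sum]
  refine Finset.sum_le_sum fun i hi => ?_
  have hcomp := jacobiNormSq_mul_derivFactor_le ha hb (by linarith) j i
  rw [sub_add_cancel, sub_add_cancel,
    show β - 1 + (α - β - 1) + 1 + 2 = α - β + β + 1 by ring] at hcomp
  have hlam := inv_lamda_sq_le hα1 β hN (Finset.mem_Ico.mp hi).1
  have hNpow : 0 ≤ (N : ℝ) ^ (-2 * (α - 1)) := Real.rpow_nonneg N.cast_nonneg _
  have hnonneg : 0 ≤ jacobiNormSq (α - β) β i * derivFactor (α - β + β + 1) j i :=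
    mul_nonneg (jacobiNormSq_nonneg _ _ _) (derivFactor_nonneg (by linarith) _ _)
  rw [hc, mul_comm (lamda α β i), ← div_div, div_eq_mul_inv _ (lamda α β i), mul_pow,
    mul_comm (_ ^ 2) ((lamda α β i)⁻¹ ^ 2), mul_assoc]
  gcongr
  linarith
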